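/- arXiv:1006.5248 — 2 statements merged into one kernel-verified Lean document; each statement's English description precedes it below -/
import Mathlib

section
/- Let d ≥ 1 and k ≥ 0 be integers, let R = ℂ[x_{i,j} : 1 ≤ i ≤ d, j ∈ ℕ], and let W be a GL(∞)-stable linear subspace of the space of homogeneous polynomials of degree k in R. Then W is spanned by the elements g·w, where w ranges over W ∩ ℂ[x_{i,j} : 1 ≤ i ≤ d, 0 ≤ j < d] and g ranges over all the GL(∞)-substitution automorphisms; in other words, W is generated as a GL(∞)-module by its intersection with the polynomial subring in the variables x_{i,j} with j < d. -/
/-- The substitution endomorphism of `R = ℂ[x_{i,j} : 1 ≤ i ≤ d, j ∈ ℕ]` attached to an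
invertible `n × n` matrix `g`: it sends `x_{i,j}` to `∑_{j' < n} g_{j',j} x_{i,j'}` for `j < n`
and fixes `x_{i,j}` for `j ≥ n`. -/
noncomputable def glSubst (d n : ℕ) (g : GL (Fin n) ℂ) :
    MvPolynomial (Fin d × ℕ) ℂ →ₐ[ℂ] MvPolynomial (Fin d × ℕ) ℂ :=
  MvPolynomial.aeval fun p =>
    if h : p.2 < n then
      ∑ j' : Fin n, ((g : Matrix (Fin n) (Fin n) ℂ) j' ⟨p.2, h⟩) •
        MvPolynomial.X (p.1, (j' : ℕ))
    else MvPolynomial.X p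

/-- A linear subspace of `R = ℂ[x_{i,j} : 1 ≤ i ≤ d, j ∈ ℕ]` is `GL(∞)`-stable if it is mapped
into itself by all the substitution automorphisms. -/
def GLStableSubspace (d : ℕ) (W : Submodule ℂ (MvPolynomial (Fin d × ℕ) ℂ)) : Prop :=
  ∀ (n : ℕ) (g : GL (Fin n) ℂ) (f : MvPolynomial (Fin d × ℕ) ℂ), f ∈ W → glSubst d n g f ∈ W

section FischerForm

open MvPolynomial

variable {σ : Type*}

/-- The Fischer (or Bombieri) sesquilinear form on complex polynomials, for which distinct
monomials are orthogonal and `⟨x^m, x^m⟩ = m!`. -/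
noncomputable def fischer (p q : MvPolynomial σ ℂ) : ℂ :=
  ∑ m ∈ p.support, (m.prod fun _ k => (k.factorial : ℂ)) * star (coeff m p) * coeff m q

theorem fischer_eq_sum {p : MvPolynomial σ ℂ} {s : Finset (σ →₀ ℕ)} (hs : p.support ⊆ s)
    (q : MvPolynomial σ ℂ) :
    fischer p q =
      ∑ m ∈ s, (m.prod fun _ k => (k.factorial : ℂ)) * star (coeff m p) * coeff m q := by
  refine Finset.sum_subset hs fun m _ hm => ?_
  simp [notMem_support_iff.1 hm]

theorem fischer_add_left (p p' q : MvPolynomial σ ℂ) :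
    fischer (p + p') q = fischer p q + fischer p' q := by
  classical
  rw [fischer_eq_sum (support_add (p := p) (q := p')),
    fischer_eq_sum (p := p) (Finset.subset_union_left (s₂ := p'.support)),
    fischer_eq_sum (p := p') (Finset.subset_union_right (s₁ := p.support)),
    ← Finset.sum_add_distrib]
  refine Finset.sum_congr rfl fun m _ => ?_
  rw [coeff_add, star_add]
  ring

theorem fischer_smul_left (c : ℂ) (p q : MvPolynomial σ ℂ) :
    fischer (c • p) q = star c * fischer p q := by
  rw [fischer_eq_sum (support_smul (a := c) (f := p)), fischer, Finset.mul_sum]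
  refine Finset.sum_congr rfl fun m _ => ?_
  rw [coeff_smul, smul_eq_mul, star_mul]
  ring

theorem fischer_conj_symm (p q : MvPolynomial σ ℂ) : star (fischer q p) = fischer p q := by
  classical
  rw [fischer_eq_sum (p := p) (Finset.subset_union_left (s₂ := q.support)),
    fischer_eq_sum (p := q) (Finset.subset_union_right (s₁ := p.support)), star_sum]
  refine Finset.sum_congr rfl fun m _ => ?_
  have h : star (m.prod fun _ k => (k.factorial : ℂ)) = m.prod fun _ k => (k.factorial : ℂ) := by
    simp [Finsupp.prod]
  rw [star_mul, star_mul, star_star, h]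
  ring

theorem fischer_add_right (p q q' : MvPolynomial σ ℂ) :
    fischer p (q + q') = fischer p q + fischer p q' := by
  rw [← fischer_conj_symm, fischer_add_left, star_add, fischer_conj_symm, fischer_conj_symm]

theorem fischer_smul_right (c : ℂ) (p q : MvPolynomial σ ℂ) :
    fischer p (c • q) = c * fischer p q := by
  rw [← fischer_conj_symm, fischer_smul_left, star_mul, star_star, fischer_conj_symm, mul_comm]

/-- `fischer p` as a linear functional. -/
noncomputable def fischerLinear (p : MvPolynomial σ ℂ) : MvPolynomial σ ℂ →ₗ[ℂ] ℂ where
  toFun := fischer p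
  map_add' := fischer_add_right p
  map_smul' c q := fischer_smul_right c p q

theorem fischer_sum_right {ι : Type*} (s : Finset ι) (p : MvPolynomial σ ℂ)
    (q : ι → MvPolynomial σ ℂ) : fischer p (∑ i ∈ s, q i) = ∑ i ∈ s, fischer p (q i) :=
  map_sum (fischerLinear p) q s

theorem fischer_sum_left {ι : Type*} (s : Finset ι) (p : ι → MvPolynomial σ ℂ)
    (q : MvPolynomial σ ℂ) : fischer (∑ i ∈ s, p i) q = ∑ i ∈ s, fischer (p i) q := by
  rw [← fischer_conj_symm, fischer_sum_right, star_sum]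
  exact Finset.sum_congr rfl fun i _ => fischer_conj_symm _ _

theorem fischer_self (p : MvPolynomial σ ℂ) :
    fischer p p = ((∑ m ∈ p.support,
      (m.prod fun _ k => (k.factorial : ℝ)) * ‖coeff m p‖ ^ 2 : ℝ) : ℂ) := by
  rw [fischer]
  push_cast
  refine Finset.sum_congr rfl fun m _ => ?_
  rw [mul_assoc, Complex.star_def, Complex.conj_mul']
  simp [Finsupp.prod]

theorem fischer_self_eq_zero {p : MvPolynomial σ ℂ} (h : fischer p p = 0) : p = 0 := by
  have hpos : ∀ m : σ →₀ ℕ, 0 < m.prod fun _ k => (k.factorial : ℝ) := fun m =>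
    Finset.prod_pos fun i _ => Nat.cast_pos.2 (Nat.factorial_pos _)
  rw [fischer_self, Complex.ofReal_eq_zero, Finset.sum_eq_zero_iff_of_nonneg
    fun m _ => mul_nonneg (hpos m).le (sq_nonneg _)] at h
  ext m
  rw [coeff_zero]
  by_contra hm
  have := h m (mem_support_iff.2 hm)
  simp [(hpos m).ne', hm] at this

/-- The Fischer form makes the polynomial ring a pre-Hilbert space. -/
noncomputable abbrev fischerCore : InnerProductSpace.Core ℂ (MvPolynomial σ ℂ) where
  inner := fischer
  conj_inner_symm := fischer_conj_symm
  re_inner_nonneg p := by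
    rw [fischer_self]
    refine Finset.sum_nonneg fun m _ => mul_nonneg ?_ (sq_nonneg _)
    exact Finset.prod_nonneg fun i _ => Nat.cast_nonneg _
  add_left := fischer_add_left
  smul_left p q c := fischer_smul_left c p q
  definite _ := fischer_self_eq_zero

theorem exists_fischer_orthogonal_decomposition (V : Submodule ℂ (MvPolynomial σ ℂ))
    [FiniteDimensional ℂ V] (f : MvPolynomial σ ℂ) :
    ∃ v ∈ V, ∃ u, (∀ w ∈ V, fischer w u = 0) ∧ f = v + u := by
  let _ : NormedAddCommGroup (MvPolynomial σ ℂ) :=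
    InnerProductSpace.Core.toNormedAddCommGroup (cd := fischerCore)
  let _ : InnerProductSpace ℂ (MvPolynomial σ ℂ) := InnerProductSpace.ofCore fischerCore.toCore
  obtain ⟨v, hv, u, hu, h⟩ := V.exists_add_mem_mem_orthogonal f
  exact ⟨v, hv, u, fun w hw => (V.mem_orthogonal u).1 hu w hw, h⟩

theorem fischer_monomial (m : σ →₀ ℕ) (c : ℂ) (q : MvPolynomial σ ℂ) :
    fischer (monomial m c) q =
      (m.prod fun _ k => (k.factorial : ℂ)) * star c * coeff m q := by
  classical
  rw [fischer_eq_sum support_monomial_subset, Finset.sum_singleton, coeff_monomial, if_pos rfl]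

theorem prod_factorial_add_single (m : σ →₀ ℕ) (a : σ) :
    ((m + Finsupp.single a 1).prod fun _ k => (k.factorial : ℂ)) =
      (m a + 1) * m.prod fun _ k => (k.factorial : ℂ) := by
  classical
  have hm : m.support ⊆ insert a m.support := Finset.subset_insert _ _
  have hm' : (m + Finsupp.single a 1).support ⊆ insert a m.support := by
    intro b hb
    by_contra h
    simp only [Finset.mem_insert, Finsupp.mem_support_iff, not_or, not_not] at h
    simp [h.2, Ne.symm h.1] at hb
  rw [Finsupp.prod_of_support_subset _ hm _ (by simp),
    Finsupp.prod_of_support_subset _ hm' _ (by simp),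
    ← Finset.mul_prod_erase _ _ (Finset.mem_insert_self a _),
    ← Finset.mul_prod_erase _ _ (Finset.mem_insert_self a m.support), ← mul_assoc]
  congr 1
  · simp [Nat.factorial_succ]
  · refine Finset.prod_congr rfl fun b hb => ?_
    simp [(Finset.ne_of_mem_erase hb).symm]

theorem fischer_mul_X (p q : MvPolynomial σ ℂ) (a : σ) :
    fischer (p * X a) q = fischer p (pderiv a q) := by
  induction p using MvPolynomial.induction_on' with
  | monomial m c =>
    rw [X, monomial_mul, mul_one, fischer_monomial, fischer_monomial, coeff_pderiv,
      prod_factorial_add_single]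
    ring
  | add p p' hp hp' => rw [add_mul, fischer_add_left, fischer_add_left, hp, hp']

end FischerForm

section MatrixSubstitution

open MvPolynomial

variable {d n : ℕ}

/-- The substitution endomorphism attached to an arbitrary `n × n` matrix. -/
noncomputable def matSubst (d : ℕ) {n : ℕ} (A : Matrix (Fin n) (Fin n) ℂ) :
    MvPolynomial (Fin d × ℕ) ℂ →ₐ[ℂ] MvPolynomial (Fin d × ℕ) ℂ :=
  aeval fun p =>
    if h : p.2 < n then ∑ j' : Fin n, (A j' ⟨p.2, h⟩) • X (p.1, (j' : ℕ)) else X p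

theorem glSubst_eq_matSubst (g : GL (Fin n) ℂ) : glSubst d n g = matSubst d (g : Matrix (Fin n) (Fin n) ℂ) :=
  rfl

theorem matSubst_X_fin (A : Matrix (Fin n) (Fin n) ℂ) (i : Fin d) (j : Fin n) :
    matSubst d A (X (i, (j : ℕ))) = ∑ j' : Fin n, A j' j • X (i, (j' : ℕ)) := by
  simp [matSubst]

theorem matSubst_X_of_le (A : Matrix (Fin n) (Fin n) ℂ) (i : Fin d) {j : ℕ} (h : n ≤ j) :
    matSubst d A (X (i, j)) = X (i, j) := by
  simp [matSubst, Nat.not_lt.2 h]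

theorem matSubst_algHom_ext {S : Type*} [Semiring S] [Algebra ℂ S] (n : ℕ)
    {φ ψ : MvPolynomial (Fin d × ℕ) ℂ →ₐ[ℂ] S}
    (hfin : ∀ i (j : Fin n), φ (X (i, (j : ℕ))) = ψ (X (i, (j : ℕ))))
    (hle : ∀ i j, n ≤ j → φ (X (i, j)) = ψ (X (i, j))) : φ = ψ := by
  refine MvPolynomial.algHom_ext fun ⟨i, j⟩ => ?_
  rcases lt_or_ge j n with h | h
  exacts [hfin i ⟨j, h⟩, hle i j h]

theorem matSubst_one : matSubst d (1 : Matrix (Fin n) (Fin n) ℂ) = AlgHom.id ℂ _ :=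
  matSubst_algHom_ext n (fun i j => by simp [matSubst_X_fin, Matrix.one_apply])
    fun i j h => by simp [matSubst_X_of_le _ _ h]

theorem matSubst_mul (A B : Matrix (Fin n) (Fin n) ℂ) (p : MvPolynomial (Fin d × ℕ) ℂ) :
    matSubst d (A * B) p = matSubst d A (matSubst d B p) := by
  rw [← AlgHom.comp_apply]
  congr 1
  refine matSubst_algHom_ext n (fun i j => ?_) fun i j h => by simp [matSubst_X_of_le _ _ h]
  simp only [AlgHom.comp_apply, matSubst_X_fin, map_sum, map_smul, Matrix.mul_apply,
    Finset.sum_smul, Finset.smul_sum, smul_smul]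
  rw [Finset.sum_comm]
  simp only [mul_comm]

theorem coeff_zero_matSubst (A : Matrix (Fin n) (Fin n) ℂ) (p : MvPolynomial (Fin d × ℕ) ℂ) :
    coeff 0 (matSubst d A p) = coeff 0 p := by
  have h : (aeval (fun _ => (0 : ℂ))).comp (matSubst d A) =
      (aeval (fun _ => (0 : ℂ)) : MvPolynomial (Fin d × ℕ) ℂ →ₐ[ℂ] ℂ) :=
    matSubst_algHom_ext n (fun i j => by simp [matSubst_X_fin])
      fun i j h => by simp [matSubst_X_of_le _ _ h]
  have := DFunLike.congr_fun h p
  simpa [aeval_zero', constantCoeff_eq] using this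

theorem pderiv_matSubst_fin (A : Matrix (Fin n) (Fin n) ℂ) (i : Fin d) (a : Fin n)
    (q : MvPolynomial (Fin d × ℕ) ℂ) :
    pderiv (i, (a : ℕ)) (matSubst d A q) =
      ∑ j : Fin n, A a j • matSubst d A (pderiv (i, (j : ℕ)) q) := by
  classical
  induction q using MvPolynomial.induction_on with
  | C c => simp [← algebraMap_eq]
  | add p q hp hq => simp [hp, hq, Finset.sum_add_distrib]
  | mul_X p b hp =>
    have hb : pderiv (i, (a : ℕ)) (matSubst d A (X b)) =
        ∑ j : Fin n, A a j • matSubst d A (pderiv (i, (j : ℕ)) (X b)) := by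
      obtain ⟨i', b⟩ := b
      rcases lt_or_ge b n with h | h
      · lift b to Fin n using h
        rw [matSubst_X_fin]
        by_cases hi : i' = i
        · subst hi
          simp [pderiv_X, Pi.single_apply, Fin.val_inj, apply_ite (matSubst d A)]
        · simp [pderiv_X, hi]
      · rw [matSubst_X_of_le _ _ h]
        have h1 : ∀ j : Fin n, b ≠ j := fun j => (j.2.trans_le h).ne'
        simp [pderiv_X, h1]
    rw [map_mul, pderiv_mul, hp, hb, Finset.sum_mul, Finset.mul_sum, ← Finset.sum_add_distrib]
    refine Finset.sum_congr rfl fun j _ => ?_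
    rw [pderiv_mul, map_add, map_mul, map_mul, smul_add, smul_mul_assoc, mul_smul_comm]

theorem pderiv_matSubst_of_le (A : Matrix (Fin n) (Fin n) ℂ) (i : Fin d) {a : ℕ} (ha : n ≤ a)
    (q : MvPolynomial (Fin d × ℕ) ℂ) :
    pderiv (i, a) (matSubst d A q) = matSubst d A (pderiv (i, a) q) := by
  classical
  induction q using MvPolynomial.induction_on with
  | C c => simp [← algebraMap_eq]
  | add p q hp hq => simp [hp, hq]
  | mul_X p b hp =>
    have hb : pderiv (i, a) (matSubst d A (X b)) = matSubst d A (pderiv (i, a) (X b)) := by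
      obtain ⟨i', b⟩ := b
      rcases lt_or_ge b n with h | h
      · have h1 : ∀ j : Fin n, (j : ℕ) ≠ a := fun j => (j.2.trans_le ha).ne
        lift b to Fin n using h
        simp [matSubst_X_fin, pderiv_X, h1]
      · rw [matSubst_X_of_le _ _ h]
        simp [pderiv_X, Pi.single_apply, apply_ite (matSubst d A)]
    rw [map_mul, pderiv_mul, hp, hb, pderiv_mul, map_add, map_mul, map_mul]

theorem fischer_matSubst_left (A : Matrix (Fin n) (Fin n) ℂ) (p q : MvPolynomial (Fin d × ℕ) ℂ) :
    fischer (matSubst d A p) q = fischer p (matSubst d A.conjTranspose q) := by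
  induction p using MvPolynomial.induction_on generalizing q with
  | C c =>
    rw [← algebraMap_eq, AlgHom.commutes, algebraMap_eq, ← monomial_zero', fischer_monomial,
      fischer_monomial, coeff_zero_matSubst]
  | add p p' hp hp' => rw [map_add, fischer_add_left, fischer_add_left, hp, hp']
  | mul_X p b hp =>
    rw [map_mul, fischer_mul_X]
    obtain ⟨i, b⟩ := b
    rcases lt_or_ge b n with h | h
    · lift b to Fin n using h
      rw [matSubst_X_fin, pderiv_matSubst_fin, Finset.mul_sum, fischer_sum_left,
        fischer_sum_right]
      refine Finset.sum_congr rfl fun j _ => ?_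
      rw [mul_smul_comm, fischer_smul_left, fischer_mul_X, hp, fischer_smul_right,
        Matrix.conjTranspose_apply]
    · rw [matSubst_X_of_le _ _ h, fischer_mul_X, hp, pderiv_matSubst_of_le _ _ h]

theorem isHomogeneous_matSubst (A : Matrix (Fin n) (Fin n) ℂ) {k : ℕ}
    {p : MvPolynomial (Fin d × ℕ) ℂ} (hp : p.IsHomogeneous k) :
    (matSubst d A p).IsHomogeneous k := by
  have h := hp.aeval (fun p : Fin d × ℕ => matSubst d A (X p)) (n := 1) ?_
  · rwa [one_mul, show aeval (fun p : Fin d × ℕ => matSubst d A (X p)) = matSubst d A from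
      MvPolynomial.algHom_ext fun _ => by simp] at h
  · rintro ⟨i, j⟩
    rcases lt_or_ge j n with h | h
    · lift j to Fin n using h
      rw [matSubst_X_fin]
      refine IsHomogeneous.sum _ _ _ fun j' _ => ?_
      rw [smul_eq_C_mul]
      exact (isHomogeneous_X ℂ _).C_mul _
    · rw [matSubst_X_of_le _ _ h]
      exact isHomogeneous_X ℂ _

theorem matSubst_mem_supported {A : Matrix (Fin n) (Fin n) ℂ} {m : ℕ}
    (hA : ∀ i j : Fin n, m ≤ i → A i j = 0) {p : MvPolynomial (Fin d × ℕ) ℂ}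
    (hp : p ∈ supported ℂ {x : Fin d × ℕ | x.2 < n}) :
    matSubst d A p ∈ supported ℂ {x : Fin d × ℕ | x.2 < m} := by
  revert p
  change supported ℂ _ ≤ (supported ℂ _).comap (matSubst d A)
  rw [supported_eq_adjoin_X (s := {x : Fin d × ℕ | x.2 < n}), Algebra.adjoin_le_iff]
  rintro _ ⟨⟨i, j⟩, hj, rfl⟩
  lift j to Fin n using hj
  rw [SetLike.mem_coe, Subalgebra.mem_comap, matSubst_X_fin]
  refine Subalgebra.sum_mem _ fun j' _ => ?_
  rcases lt_or_ge (j' : ℕ) m with h | h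
  · exact Subalgebra.smul_mem _ (X_mem_supported (R := ℂ) (i := (i, (j' : ℕ))) |>.2 h) _
  · rw [hA _ _ h, zero_smul]
    exact Subalgebra.zero_mem _

end MatrixSubstitution

section Stability

open MvPolynomial

variable {d n : ℕ}

theorem Submodule.eval_zero_mem_of_infinite {R : Type*} [CommRing R] [Algebra ℂ R]
    (W : Submodule ℂ R) (Q : Polynomial R)
    (hQ : {t : ℂ | Q.eval (algebraMap ℂ R t) ∈ W}.Infinite) : Q.eval 0 ∈ W := by
  by_contra h
  obtain ⟨l, hl, hW⟩ := Submodule.exists_le_ker_of_notMem h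
  have key : ∀ t : ℂ, (∑ i ∈ Finset.range (Q.natDegree + 1),
      Polynomial.monomial i (l (Q.coeff i))).eval t = l (Q.eval (algebraMap ℂ R t)) := by
    intro t
    rw [Q.eval_eq_sum_range, map_sum, Polynomial.eval_finsetSum]
    refine Finset.sum_congr rfl fun i _ => ?_
    rw [Polynomial.eval_monomial, ← map_pow, mul_comm (Q.coeff i), ← Algebra.smul_def, map_smul,
      smul_eq_mul, mul_comm]
  have hzero := Polynomial.eq_zero_of_infinite_isRoot _ (hQ.mono fun t ht =>
    show Polynomial.IsRoot _ t from (key t).trans (hW ht))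
  have h0 := key 0
  rw [hzero, Polynomial.eval_zero, map_zero] at h0
  exact hl h0.symm

/-- A subspace stable under `GL n` is stable under all `n × n` matrices, since `A + t` is
invertible for all but finitely many `t`. -/
theorem matSubst_mem_of_glSubst_mem {W : Submodule ℂ (MvPolynomial (Fin d × ℕ) ℂ)}
    (hW : ∀ (g : GL (Fin n) ℂ), ∀ f ∈ W, glSubst d n g f ∈ W)
    (A : Matrix (Fin n) (Fin n) ℂ) {f : MvPolynomial (Fin d × ℕ) ℂ} (hf : f ∈ W) :
    matSubst d A f ∈ W := by
  let Q : Polynomial (MvPolynomial (Fin d × ℕ) ℂ) :=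
    aeval (fun x : Fin d × ℕ => Polynomial.C (matSubst d A (X x)) +
      if x.2 < n then Polynomial.X * Polynomial.C (X x) else 0) f
  have hQ : ∀ t : ℂ, Q.eval (algebraMap ℂ _ t) = matSubst d (A + Matrix.scalar (Fin n) t) f := by
    intro t
    have : ((Polynomial.aeval (algebraMap ℂ (MvPolynomial (Fin d × ℕ) ℂ) t)).restrictScalars
        ℂ).comp (aeval (fun x : Fin d × ℕ => Polynomial.C (matSubst d A (X x)) +
          if x.2 < n then Polynomial.X * Polynomial.C (X x) else 0)) =
        matSubst d (A + Matrix.scalar (Fin n) t) := by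
      refine matSubst_algHom_ext n (fun i j => ?_) fun i j h => ?_
      · simp [matSubst_X_fin, Matrix.diagonal_apply, Algebra.smul_def, Polynomial.eval_finsetSum,
          add_mul, Finset.sum_add_distrib, apply_ite C, mul_comm (X _) (C t)]
      · simp [matSubst_X_of_le _ _ h, Nat.not_lt.2 h]
    rw [← this]
    simp [Q]
  have h0 := W.eval_zero_mem_of_infinite Q ?_
  · have h := hQ 0
    rw [map_zero, map_zero, add_zero] at h
    rwa [← h]
  · refine (Set.Finite.infinite_compl (s := {t : ℂ | (-A).charpoly.IsRoot t})
      (Polynomial.finite_setOfPred_isRoot (Matrix.charpoly_monic (-A)).ne_zero)).mono fun t ht => ?_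
    have hdet : IsUnit (A + Matrix.scalar (Fin n) t).det := by
      rw [isUnit_iff_ne_zero]
      intro h
      apply ht
      rw [Set.mem_ofPred_eq, Polynomial.IsRoot, Matrix.eval_charpoly, sub_neg_eq_add, add_comm, h]
    rw [Set.mem_ofPred_eq, hQ]
    exact hW (Matrix.nonsingInvUnit _ hdet) f hf

theorem finiteDimensional_of_homogeneous_of_supported
    {σ : Type*} {V : Submodule ℂ (MvPolynomial σ ℂ)} (s : Finset σ) (k : ℕ)
    (hhom : V ≤ homogeneousSubmodule σ ℂ k)
    (hs : V ≤ (supported ℂ (s : Set σ)).toSubmodule) : FiniteDimensional ℂ V := by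
  classical
  have hle : V ≤ Submodule.span ℂ
      (((s.finsuppAntidiag k).image fun m => monomial m (1 : ℂ) : Finset (MvPolynomial σ ℂ)) :
        Set (MvPolynomial σ ℂ)) := by
    intro p hp
    rw [p.as_sum]
    refine Submodule.sum_mem _ fun m hm => ?_
    rw [← mul_one (coeff m p), ← smul_eq_mul, ← smul_monomial]
    refine Submodule.smul_mem _ _ (Submodule.subset_span ?_)
    rw [Finset.coe_image]
    refine Set.mem_image_of_mem _ ?_
    have hsub : m.support ⊆ s := fun i hi =>
      mem_supported.1 (hs hp) ((mem_vars_iff_mem_support i).2 ⟨m, hm, hi⟩)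
    have hdeg := hhom hp (mem_support_iff.1 hm)
    rw [Pi.one_def, ← Finsupp.degree_eq_weight_one] at hdeg
    rw [Finset.mem_coe, Finset.mem_finsuppAntidiag]
    refine ⟨?_, hsub⟩
    rw [← hdeg, Finsupp.degree]
    exact (Finset.sum_subset hsub fun i _ hi => by simpa using hi).symm
  exact Submodule.finiteDimensional_of_le hle

end Stability

section FinitePart

open MvPolynomial

variable {d n k : ℕ} {W : Submodule ℂ (MvPolynomial (Fin d × ℕ) ℂ)}

/-- The span of the `GL n`-translates of the elements of `W` in the variables `x_{i,j}`, `j < d`. -/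
noncomputable def glSpan (n : ℕ) (W : Submodule ℂ (MvPolynomial (Fin d × ℕ) ℂ)) :
    Submodule ℂ (MvPolynomial (Fin d × ℕ) ℂ) :=
  Submodule.span ℂ { y | ∃ (g : GL (Fin n) ℂ) (w : MvPolynomial (Fin d × ℕ) ℂ),
    w ∈ W ∧ w ∈ supported ℂ {p : Fin d × ℕ | p.2 < d} ∧ y = glSubst d n g w }

theorem glSubst_mem_glSpan_of_mem (g : GL (Fin n) ℂ) {w : MvPolynomial (Fin d × ℕ) ℂ} (hw : w ∈ W)
    (hwd : w ∈ supported ℂ {p : Fin d × ℕ | p.2 < d}) : glSubst d n g w ∈ glSpan n W :=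
  Submodule.subset_span ⟨g, w, hw, hwd, rfl⟩

theorem glSpan_le {V : Submodule ℂ (MvPolynomial (Fin d × ℕ) ℂ)}
    (h : ∀ (g : GL (Fin n) ℂ), ∀ w ∈ W, w ∈ supported ℂ {p : Fin d × ℕ | p.2 < d} →
      glSubst d n g w ∈ V) : glSpan n W ≤ V := by
  refine Submodule.span_le.2 ?_
  rintro y ⟨g, w, hw, hwd, hy⟩
  rw [hy]
  exact h g w hw hwd

theorem mem_glSpan {w : MvPolynomial (Fin d × ℕ) ℂ} (hw : w ∈ W)
    (hwd : w ∈ supported ℂ {p : Fin d × ℕ | p.2 < d}) : w ∈ glSpan n W := by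
  have h := glSubst_mem_glSpan_of_mem (1 : GL (Fin n) ℂ) hw hwd
  rwa [glSubst_eq_matSubst, Units.val_one, matSubst_one, AlgHom.id_apply] at h

theorem glSubst_mem_glSpan (g : GL (Fin n) ℂ) {p : MvPolynomial (Fin d × ℕ) ℂ}
    (hp : p ∈ glSpan n W) : glSubst d n g p ∈ glSpan n W := by
  suffices h : glSpan n W ≤ (glSpan n W).comap (glSubst d n g).toLinearMap from h hp
  refine glSpan_le fun h w hw hwd => ?_
  rw [Submodule.mem_comap, AlgHom.toLinearMap_apply, glSubst_eq_matSubst, glSubst_eq_matSubst,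
    ← matSubst_mul, ← Units.val_mul, ← glSubst_eq_matSubst]
  exact glSubst_mem_glSpan_of_mem _ hw hwd

theorem glSpan_le_supported (hdn : d ≤ n) :
    glSpan n W ≤ (supported ℂ {x : Fin d × ℕ | x.2 < n}).toSubmodule := by
  refine glSpan_le fun g w _ hwd => ?_
  rw [Subalgebra.mem_toSubmodule, glSubst_eq_matSubst]
  exact matSubst_mem_supported (fun i _ h => absurd i.2 (Nat.not_lt.2 h))
    (supported_mono (fun x hx => lt_of_lt_of_le hx hdn) hwd)

/-- Every value of `u` is a value of some `matSubst d A u` with `A` supported on the first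
`d` rows. -/
theorem eq_zero_of_matSubst_eq_zero (hdn : d ≤ n) {u : MvPolynomial (Fin d × ℕ) ℂ}
    (hu : ∀ A : Matrix (Fin n) (Fin n) ℂ, (∀ i j : Fin n, d ≤ i → A i j = 0) →
      matSubst d A u = 0) : u = 0 := by
  refine MvPolynomial.funext fun x => ?_
  let A : Matrix (Fin n) (Fin n) ℂ :=
    Matrix.of fun i j => if h : (i : ℕ) < d then x (⟨i, h⟩, (j : ℕ)) else 0
  let y : Fin d × ℕ → ℂ := fun p => if p.2 < n then if p.2 = p.1 then 1 else 0 else x p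
  have hev : (aeval y).comp (matSubst d A) =
      (aeval x : MvPolynomial (Fin d × ℕ) ℂ →ₐ[ℂ] ℂ) := by
    refine matSubst_algHom_ext n (fun i j => ?_) fun i j h => ?_
    · rw [AlgHom.comp_apply, matSubst_X_fin, map_sum,
        Finset.sum_eq_single ⟨i, i.2.trans_le hdn⟩]
      · simp [A, y, i.2.trans_le hdn]
      · intro j' _ hj'
        have : (j' : ℕ) ≠ i := fun h => hj' (Fin.ext h)
        simp [y, this]
      · simp
    · simp [matSubst_X_of_le _ _ h, y, Nat.not_lt.2 h]
  have h := DFunLike.congr_fun hev u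
  rw [AlgHom.comp_apply, hu A fun i j h => by simp [A, Nat.not_lt.2 h], map_zero] at h
  simpa [aeval_eq_eval] using h.symm

theorem mem_glSpan_of_mem_supported (hdn : d ≤ n)
    (hhom : W ≤ homogeneousSubmodule (Fin d × ℕ) ℂ k)
    (hstab : ∀ (g : GL (Fin n) ℂ), ∀ f ∈ W, glSubst d n g f ∈ W)
    {f : MvPolynomial (Fin d × ℕ) ℂ} (hf : f ∈ W)
    (hfn : f ∈ supported ℂ {x : Fin d × ℕ | x.2 < n}) : f ∈ glSpan n W := by
  have hVW : glSpan n W ≤ W := glSpan_le fun g w hw _ => hstab g w hw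
  have hVn := glSpan_le_supported (W := W) hdn
  have hfin : FiniteDimensional ℂ (glSpan n W) := by
    refine finiteDimensional_of_homogeneous_of_supported (Finset.univ ×ˢ Finset.range n) k
      (hVW.trans hhom) (hVn.trans (supported_mono fun x hx => ?_))
    simpa using hx
  obtain ⟨v, hv, u, hu, h⟩ := exists_fischer_orthogonal_decomposition (glSpan n W) f
  have hfv : u = f - v := by rw [h, add_sub_cancel_left]
  have huW : u ∈ W := hfv ▸ W.sub_mem hf (hVW hv)
  have hun : u ∈ supported ℂ {x : Fin d × ℕ | x.2 < n} := hfv ▸ Subalgebra.sub_mem _ hfn (hVn hv)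
  rw [h, eq_zero_of_matSubst_eq_zero hdn (u := u) fun A hA => ?_, add_zero]
  · exact hv
  have hAV : matSubst d A u ∈ glSpan n W :=
    mem_glSpan (matSubst_mem_of_glSubst_mem hstab A huW) (matSubst_mem_supported hA hun)
  refine fischer_self_eq_zero ?_
  rw [← A.conjTranspose_conjTranspose, ← fischer_matSubst_left, A.conjTranspose_conjTranspose]
  exact hu _ (matSubst_mem_of_glSubst_mem (fun g p hp => glSubst_mem_glSpan g hp) _ hAV)

theorem exists_le_mem_supported (f : MvPolynomial (Fin d × ℕ) ℂ) :
    ∃ n, d ≤ n ∧ f ∈ supported ℂ {x : Fin d × ℕ | x.2 < n} := by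
  refine ⟨max d (f.vars.sup Prod.snd + 1), le_max_left _ _, mem_supported.2 ?_⟩
  intro x hx
  exact (Nat.lt_succ_of_le (Finset.le_sup (f := Prod.snd) hx)).trans_le (le_max_right _ _)

end FinitePart

/-- (Weyl) A `GL(∞)`-stable subspace `W` of `Sym^k(ℂ^d ⊗ ℂ^∞)`, i.e. of the space of homogeneous
polynomials of degree `k` in `ℂ[x_{i,j} : 1 ≤ i ≤ d, j ∈ ℕ]`, is spanned by the `GL(∞)`-translates
of its intersection with the polynomial subring `ℂ[x_{i,j} : 1 ≤ i ≤ d, 0 ≤ j < d]`. -/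
theorem glStable_subspace_spanned_by_translates_of_finite_part (d k : ℕ) (hd : 1 ≤ d)
    (W : Submodule ℂ (MvPolynomial (Fin d × ℕ) ℂ))
    (hhom : W ≤ MvPolynomial.homogeneousSubmodule (Fin d × ℕ) ℂ k)
    (hstab : GLStableSubspace d W) :
    W = Submodule.span ℂ
      { y | ∃ (n : ℕ) (g : GL (Fin n) ℂ) (w : MvPolynomial (Fin d × ℕ) ℂ),
          w ∈ W ∧ w ∈ MvPolynomial.supported ℂ {p : Fin d × ℕ | p.2 < d} ∧
          y = glSubst d n g w } := by
  refine le_antisymm (fun f hf => ?_) (Submodule.span_le.2 ?_)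
  · obtain ⟨n, hdn, hfn⟩ := exists_le_mem_supported f
    refine glSpan_le (fun g w hw hwd => ?_)
      (mem_glSpan_of_mem_supported hdn hhom (hstab n) hf hfn)
    exact Submodule.subset_span ⟨n, g, w, hw, hwd, rfl⟩
  · rintro y ⟨n, g, w, hw, -, hy⟩
    rw [hy]
    exact hstab n g w hw
end

section
/- Let U be a finite-dimensional complex vector space and let M = ((M_n), (μ_n)) be a finitely generated module over the twisted commutative algebra Sym(U⟨1⟩), presented in the sequence model. Then the exponential Hilbert series H_M(t) = ∑_{n≥0} (dim_ℂ M_n / n!) t^n, regarded as a formal power series in ℚ[[t]], is a polynomial in t and e^t: there exists a polynomial P ∈ ℚ[X,Y] such that H_M(t) = P(t, exp(t)) in ℚ[[t]], where exp(t) = ∑_{n≥0} t^n/n!. -/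
noncomputable section

/-- The extension of a permutation of `{1, …, n}` to a permutation of `{1, …, n+1}`
fixing the letter `n+1`. -/
def permExtend {n : ℕ} (σ : Equiv.Perm (Fin n)) : Equiv.Perm (Fin (n + 1)) :=
  σ.viaFintypeEmbedding Fin.castSuccEmb

/-- A finitely generated module over the twisted commutative algebra `Sym(U⟨1⟩)`, presented in
the sequence model: finite-dimensional `S_n`-representations `M n` together with multiplication
maps `μ n : U ⊗ M n → M (n+1)` which are equivariant, symmetric in the two `U`-factors
(up to the transposition of the last two letters), and eventually generating. -/
structure SeqModule (U : Type) [AddCommGroup U] [Module ℂ U] where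
  M : ℕ → Type
  [addCommGroup : ∀ n, AddCommGroup (M n)]
  [module : ∀ n, Module ℂ (M n)]
  [finiteDimensional : ∀ n, FiniteDimensional ℂ (M n)]
  ρ : ∀ n, Representation ℂ (Equiv.Perm (Fin n)) (M n)
  μ : ∀ n, U →ₗ[ℂ] M n →ₗ[ℂ] M (n + 1)
  equivariant : ∀ (n : ℕ) (σ : Equiv.Perm (Fin n)) (u : U) (x : M n),
    μ n u (ρ n σ x) = ρ (n + 1) (permExtend σ) (μ n u x)
  symmetric : ∀ (n : ℕ) (u v : U) (x : M n),
    ρ (n + 2) (Equiv.swap ((Fin.last n).castSucc) (Fin.last (n + 1)))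
        (μ (n + 1) u (μ n v x)) = μ (n + 1) v (μ n u x)
  finitelyGenerated : ∃ N : ℕ, ∀ n : ℕ, N ≤ n →
    (⊤ : Submodule ℂ (M (n + 1))) ≤ Submodule.span ℂ
      { y | ∃ (σ : Equiv.Perm (Fin (n + 1))) (u : U) (x : M n), y = ρ (n + 1) σ (μ n u x) }

attribute [instance] SeqModule.addCommGroup SeqModule.module SeqModule.finiteDimensional

/-- The ring of power series that are polynomials in `t` and `e^t`. -/
def polyExp : Subalgebra ℚ (PowerSeries ℚ) :=
  (MvPolynomial.aeval ![PowerSeries.X, PowerSeries.exp ℚ] :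
    MvPolynomial (Fin 2) ℚ →ₐ[ℚ] PowerSeries ℚ).range

lemma X_mem_polyExp : (PowerSeries.X : PowerSeries ℚ) ∈ polyExp :=
  ⟨MvPolynomial.X 0, by simp⟩

lemma exp_mem_polyExp : PowerSeries.exp ℚ ∈ polyExp :=
  ⟨MvPolynomial.X 1, by simp⟩

lemma derivative_X_pow_mul_exp_pow (a m : ℕ) :
    PowerSeries.derivative ℚ (PowerSeries.X ^ a * PowerSeries.exp ℚ ^ m) =
      (a : ℚ) • (PowerSeries.X ^ (a - 1) * PowerSeries.exp ℚ ^ m) +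
        (m : ℚ) • (PowerSeries.X ^ a * PowerSeries.exp ℚ ^ m) := by
  have h (m : ℕ) : PowerSeries.derivative ℚ (PowerSeries.exp ℚ ^ m) =
      (m : ℚ) • PowerSeries.exp ℚ ^ m := by
    cases m with
    | zero => simp
    | succ m =>
      rw [PowerSeries.derivative_pow, PowerSeries.derivative_exp, Algebra.smul_def]
      simp [pow_succ, mul_assoc]
  rw [Derivation.leibniz, h, PowerSeries.derivative_pow, PowerSeries.derivative_X]
  simp only [smul_eq_mul, Algebra.smul_def, map_natCast]
  ring

/-- The operator `y ↦ y' - k y` is surjective on polynomials in `t` and `e^t`. -/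
lemma exists_derivative_sub_smul_eq (k : ℕ) {z : PowerSeries ℚ} (hz : z ∈ polyExp) :
    ∃ y ∈ polyExp, PowerSeries.derivative ℚ y - (k : ℚ) • y = z := by
  have mon (a m : ℕ) : ∃ y ∈ polyExp, PowerSeries.derivative ℚ y - (k : ℚ) • y =
      PowerSeries.X ^ a * PowerSeries.exp ℚ ^ m := by
    have mem (a m : ℕ) : PowerSeries.X ^ a * PowerSeries.exp ℚ ^ m ∈ polyExp :=
      mul_mem (pow_mem X_mem_polyExp a) (pow_mem exp_mem_polyExp m)
    by_cases hm : m = k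
    · subst hm
      refine ⟨((a : ℚ) + 1)⁻¹ • (PowerSeries.X ^ (a + 1) * PowerSeries.exp ℚ ^ m),
        polyExp.smul_mem (mem _ _) _, ?_⟩
      have ha : (a : ℚ) + 1 ≠ 0 := by positivity
      rw [Derivation.map_smul, derivative_X_pow_mul_exp_pow]
      simp only [Nat.cast_add, Nat.cast_one, Nat.add_sub_cancel]
      match_scalars <;> field_simp
      ring
    · have hk : (m : ℚ) - k ≠ 0 := sub_ne_zero.2 (by exact_mod_cast hm)
      induction a with
      | zero =>
        refine ⟨((m : ℚ) - k)⁻¹ • (PowerSeries.X ^ 0 * PowerSeries.exp ℚ ^ m),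
          polyExp.smul_mem (mem _ _) _, ?_⟩
        rw [Derivation.map_smul, derivative_X_pow_mul_exp_pow]
        simp only [Nat.cast_zero, zero_smul, zero_add]
        match_scalars
        field_simp
      | succ a ih =>
        obtain ⟨y, hy, e⟩ := ih
        refine ⟨((m : ℚ) - k)⁻¹ • (PowerSeries.X ^ (a + 1) * PowerSeries.exp ℚ ^ m -
          ((a : ℚ) + 1) • y),
          polyExp.smul_mem (sub_mem (mem _ _) (polyExp.smul_mem hy _)) _, ?_⟩
        rw [Derivation.map_smul, map_sub, Derivation.map_smul, derivative_X_pow_mul_exp_pow,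
          eq_add_of_sub_eq e]
        simp only [Nat.cast_add, Nat.cast_one, Nat.add_sub_cancel]
        match_scalars <;> field_simp <;> ring
  obtain ⟨P, rfl⟩ := hz
  change ∃ y ∈ polyExp, _ = MvPolynomial.aeval ![PowerSeries.X, PowerSeries.exp ℚ] P
  induction P using MvPolynomial.induction_on' with
  | monomial u c =>
    obtain ⟨y, hy, e⟩ := mon (u 0) (u 1)
    refine ⟨c • y, polyExp.smul_mem hy _, ?_⟩
    rw [Derivation.map_smul, smul_comm, ← smul_sub, e, MvPolynomial.aeval_monomial,
      Finsupp.prod_fintype _ _ (by simp)]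
    simp [Algebra.smul_def]
  | add p q hp hq =>
    obtain ⟨y, hy, e⟩ := hp
    obtain ⟨y', hy', e'⟩ := hq
    refine ⟨y + y', add_mem hy hy', ?_⟩
    rw [map_add, map_add, ← e, ← e', smul_add]
    abel

/-- The sequences whose exponential generating function is a polynomial in `t` and `e^t`. -/
def IsPolyExp (a : ℕ → ℚ) : Prop :=
  (PowerSeries.mk fun n => a n / (n.factorial : ℚ)) ∈ polyExp

namespace IsPolyExp

lemma zero : IsPolyExp fun _ => 0 := by
  have : (PowerSeries.mk fun n : ℕ => (0 : ℚ) / (n.factorial : ℚ)) = 0 := by ext; simp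
  rw [IsPolyExp, this]
  exact zero_mem _

lemma add {a b : ℕ → ℚ} (ha : IsPolyExp a) (hb : IsPolyExp b) :
    IsPolyExp fun n => a n + b n := by
  have : (PowerSeries.mk fun n : ℕ => (a n + b n) / (n.factorial : ℚ)) =
      (PowerSeries.mk fun n => a n / (n.factorial : ℚ)) +
        (PowerSeries.mk fun n => b n / (n.factorial : ℚ)) := by ext; simp [add_div]
  rw [IsPolyExp, this]
  exact add_mem ha hb

lemma sum {ι : Type*} {s : Finset ι} {a : ι → ℕ → ℚ} (h : ∀ i ∈ s, IsPolyExp (a i)) :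
    IsPolyExp fun n => ∑ i ∈ s, a i n := by
  classical
  induction s using Finset.induction_on with
  | empty => simpa using zero
  | insert i s hi ih =>
    simp only [Finset.sum_insert hi]
    exact (h i (Finset.mem_insert_self i s)).add
      (ih fun j hj => h j (Finset.mem_insert_of_mem hj))

lemma of_recurrence {a b : ℕ → ℚ} (k : ℕ) (hb : IsPolyExp b)
    (h : ∀ n, a (n + 1) = k * a n + b n) : IsPolyExp a := by
  obtain ⟨y, hy, e⟩ := exists_derivative_sub_smul_eq k hb
  have key : (PowerSeries.mk fun n => a n / (n.factorial : ℚ)) =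
      y + (a 0 - PowerSeries.coeff 0 y) • PowerSeries.exp ℚ ^ k := by
    ext n
    rw [PowerSeries.exp_pow_eq_rescale_exp]
    induction n with
    | zero => simp [PowerSeries.coeff_rescale, -PowerSeries.coeff_zero_eq_constantCoeff]
    | succ n ih =>
      have e' := congrArg (PowerSeries.coeff n) e
      simp only [map_sub, PowerSeries.coeff_derivative, map_smul, PowerSeries.coeff_mk,
        smul_eq_mul, map_add, PowerSeries.coeff_rescale, PowerSeries.coeff_exp] at e' ih ⊢
      have hn : (n : ℚ) + 1 ≠ 0 := by positivity
      have hf : (n.factorial : ℚ) ≠ 0 := by positivity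
      rw [h, Nat.factorial_succ]
      simp only [eq_ratCast, Rat.cast_id] at ih ⊢
      have e'' : PowerSeries.coeff (n + 1) y =
        (b n / n.factorial + k * PowerSeries.coeff n y) / (n + 1) := by
        field_simp
        field_simp at e'
        linear_combination e'
      have ih' : a n = n.factorial * (PowerSeries.coeff n y) +
          (a 0 - PowerSeries.coeff 0 y) * k ^ n := by
        field_simp at ih
        linear_combination ih
      rw [e'', ih']
      push_cast
      field_simp
      ring
  rw [IsPolyExp, key]
  exact add_mem hy (polyExp.smul_mem (pow_mem exp_mem_polyExp k) _)

lemma of_eventually_zero {N : ℕ} {a : ℕ → ℚ} (h : ∀ n, N ≤ n → a n = 0) : IsPolyExp a := by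
  induction N generalizing a with
  | zero =>
    have : a = fun _ => 0 := funext fun n => h n n.zero_le
    rw [this]
    exact zero
  | succ N ih =>
    exact of_recurrence 0 (ih (a := fun n => a (n + 1)) fun n hn => h _ (by omega)) (by simp)

lemma of_eventually_eq {N : ℕ} {a b : ℕ → ℚ} (hb : IsPolyExp b)
    (h : ∀ n, N ≤ n → a n = b n) : IsPolyExp a := by
  have := hb.add (of_eventually_zero (a := fun n => a n - b n) (N := N)
    fun n hn => sub_eq_zero.2 (h n hn))
  simpa using this

end IsPolyExp

/-- The finite set of words of length `n`. -/
def words (B : Type*) [Fintype B] [DecidableEq B] : ℕ → Finset (List B)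
  | 0 => {[]}
  | n + 1 => (Finset.univ ×ˢ words B n).image fun p => p.1 :: p.2

lemma mem_words {B : Type*} [Fintype B] [DecidableEq B] {n : ℕ} {w : List B} :
    w ∈ words B n ↔ w.length = n := by
  induction n generalizing w with
  | zero => simp [words]
  | succ n ih => cases w <;> simp [words, ih]

open Classical in
/-- The number of words of length `n` in a language. -/
def wordCount {B : Type*} [Fintype B] [DecidableEq B] (L : Set (List B)) (n : ℕ) : ℚ :=
  ∑ w ∈ words B n, if w ∈ L then 1 else 0

lemma wordCount_succ {B : Type*} [Fintype B] [DecidableEq B] (L : Set (List B)) (n : ℕ) :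
    wordCount L (n + 1) = ∑ b, wordCount {w | b :: w ∈ L} n := by
  rw [wordCount, words, Finset.sum_image (by rintro ⟨⟩ _ ⟨⟩ _ h; simpa using h),
    Finset.sum_product]
  rfl

lemma wordCount_empty {B : Type*} [Fintype B] [DecidableEq B] (n : ℕ) :
    wordCount (∅ : Set (List B)) n = 0 := by
  simp [wordCount]

/-- A language closed under passing to subwords. -/
def IsSubwordClosed {B : Type*} (D : Set (List B)) : Prop :=
  ∀ ⦃u w⦄, List.Sublist u w → w ∈ D → u ∈ D

lemma IsSubwordClosed.quotient {B : Type*} {D : Set (List B)} (hD : IsSubwordClosed D) (b : B) :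
    IsSubwordClosed {w | b :: w ∈ D} :=
  fun _ _ h hw => hD (h.cons_cons b) hw

lemma IsSubwordClosed.quotient_subset {B : Type*} {D : Set (List B)} (hD : IsSubwordClosed D)
    (b : B) : {w | b :: w ∈ D} ⊆ D :=
  fun w hw => hD (List.sublist_cons_self b w) hw

/-- Subword-closed languages over a finite alphabet satisfy the descending chain condition, by
Higman's lemma. -/
lemma wellFounded_isSubwordClosed (B : Type*) [Finite B] :
    WellFounded fun D E : {D : Set (List B) // IsSubwordClosed D} => D.1 ⊂ E.1 := by
  rw [wellFounded_iff_isEmpty_descending_chain]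
  refine ⟨fun ⟨D, hD⟩ => ?_⟩
  have anti : Antitone fun n => (D n).1 := antitone_nat_of_succ_le fun n => (hD n).subset
  choose w hw hw' using fun n => Set.exists_of_ssubset (hD n)
  have higman := Set.PartiallyWellOrderedOn.partiallyWellOrderedOn_sublistForall₂
    (α := B) (· = ·) (s := Set.univ)
    (Set.Finite.partiallyWellOrderedOn Set.finite_univ)
  obtain ⟨i, j, hij, h⟩ := higman.exists_lt (f := w) (by simp)
  obtain ⟨l, hl, hs⟩ := List.sublistForall₂_iff.1 h
  rw [List.forall₂_eq_eq_eq] at hl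
  subst hl
  exact hw' i ((D (i + 1)).2 hs (anti hij (hw j)))

/-- The number of words of given length in a subword-closed language that contain a given letter
a prescribed number of times. -/
lemma isPolyExp_wordCount {B : Type*} [Fintype B] [DecidableEq B] (s : B) (N : ℕ)
    {D : Set (List B)} (hD : IsSubwordClosed D) :
    IsPolyExp (wordCount {w | w ∈ D ∧ w.count s = N}) := by
  classical
  induction N using Nat.strong_induction_on generalizing D with
  | _ N ihN =>
  suffices H : ∀ D : {D : Set (List B) // IsSubwordClosed D},
      IsPolyExp (wordCount {w | w ∈ D.1 ∧ w.count s = N}) from H ⟨D, hD⟩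
  intro D
  induction D using (wellFounded_isSubwordClosed B).induction with
  | _ D ih =>
  obtain ⟨D, hD⟩ := D
  set A : Finset B := {b | b ≠ s ∧ {w | b :: w ∈ D} = D} with hA
  refine IsPolyExp.of_recurrence A.card
    (b := fun n => ∑ b ∈ Aᶜ, wordCount {w | b :: w ∈ D ∧ (b :: w).count s = N} n)
    (IsPolyExp.sum fun b hb => ?_) fun n => ?_
  · by_cases hbs : b = s
    · subst hbs
      cases N with
      | zero =>
        have : {w | b :: w ∈ D ∧ (b :: w).count b = 0} = ∅ := by ext; simp
        rw [this]
        rw [funext (wordCount_empty (B := B))]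
        exact IsPolyExp.zero
      | succ N =>
        simpa using ihN N (by omega) (hD.quotient b)
    · have hne : {w | b :: w ∈ D} ≠ D := fun h => by simp [hA, hbs, h] at hb
      have := ih ⟨_, hD.quotient b⟩ ((hD.quotient_subset b).ssubset_of_ne hne)
      simpa [List.count_cons_of_ne hbs] using this
  · rw [wordCount_succ, ← Finset.sum_add_sum_compl A]
    congr 1
    rw [Finset.sum_congr rfl (g := fun _ => wordCount {w | w ∈ D ∧ w.count s = N} n),
      Finset.sum_const, nsmul_eq_mul]
    intro b hb
    obtain ⟨hbs, hb⟩ : b ≠ s ∧ {w | b :: w ∈ D} = D := by simpa [hA] using hb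
    congr 1
    ext w
    have := Set.ext_iff.1 hb w
    simp only [Set.mem_ofPred_eq] at this ⊢
    rw [this, List.count_cons_of_ne hbs]

/-- A language closed under inserting letters other than `s` is closed under passing to
superwords with the same number of letters `s`. -/
lemma mem_of_sublist_of_count_eq {B : Type*} [DecidableEq B] {s : B} {P : Set (List B)}
    (hP : ∀ l r b, b ≠ s → l ++ r ∈ P → l ++ b :: r ∈ P) {u w : List B} (h : u.Sublist w)
    (hc : u.count s = w.count s) (hu : u ∈ P) : w ∈ P := by
  suffices H : ∀ p, p ++ u ∈ P → p ++ w ∈ P from H [] hu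
  clear hu
  induction h with
  | slnil => exact fun _ => id
  | cons b h ih =>
    intro p hp
    have hle := h.count_le s
    have hb : b ≠ s := by
      rintro rfl
      rw [List.count_cons_self] at hc
      omega
    rw [List.count_cons_of_ne hb] at hc
    exact hP _ _ _ hb (ih hc p hp)
  | cons_cons b h ih =>
    intro p hp
    have := ih (by simpa [List.count_cons] using hc) (p ++ [b]) (by simpa using hp)
    simpa using this

open Classical in
/-- The dimension of the span of a finite linearly ordered family is the number of members that
do not lie in the span of the preceding ones. -/
lemma finrank_span_image_eq_card {K V ι : Type*} [Field K] [AddCommGroup V] [Module K V]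
    [LinearOrder ι] (v : ι → V) (s : Finset ι) :
    Module.finrank K (Submodule.span K (v '' (s : Set ι))) =
      (s.filter fun i => v i ∉ Submodule.span K (v '' {j | j ∈ s ∧ j < i})).card := by
  suffices H : LinearIndepOn K v
      (s.filter fun i => v i ∉ Submodule.span K (v '' {j | j ∈ s ∧ j < i}) : Finset ι) ∧
      Submodule.span K (v '' (s.filter fun i =>
        v i ∉ Submodule.span K (v '' {j | j ∈ s ∧ j < i}) : Finset ι)) =
      Submodule.span K (v '' (s : Set ι)) by
    have := finrank_span_eq_card H.1
    rw [← H.2, Set.image_eq_range]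
    simpa using this
  induction s using Finset.induction_on_max with
  | empty => simp
  | insert a s ha ih =>
    have h1 : {j | j ∈ insert a s ∧ j < a} = (s : Set ι) := by
      ext j
      simp only [Finset.mem_insert, Set.mem_ofPred_eq, Finset.mem_coe]
      exact ⟨fun h => h.1.resolve_left h.2.ne, fun h => ⟨.inr h, ha j h⟩⟩
    have h2 : ∀ i ∈ s, {j | j ∈ insert a s ∧ j < i} = {j | j ∈ s ∧ j < i} := by
      intro i hi
      ext j
      simp only [Finset.mem_insert, Set.mem_ofPred_eq]
      refine ⟨fun h => ⟨h.1.resolve_left ?_, h.2⟩, fun h => ⟨.inr h.1, h.2⟩⟩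
      rintro rfl
      exact lt_asymm h.2 (ha i hi)
    rw [Finset.filter_insert, h1, Finset.filter_congr
      (q := fun i => v i ∉ Submodule.span K (v '' {j | j ∈ s ∧ j < i}))
      (fun i hi => by rw [h2 i hi]), Finset.coe_insert, Set.image_insert_eq]
    split_ifs with h
    · rw [Submodule.span_insert_eq_span h]
      exact ih
    · rw [Finset.coe_insert, Set.image_insert_eq, Submodule.span_insert, Submodule.span_insert,
        ih.2]
      refine ⟨ih.1.insert ?_, rfl⟩
      rwa [ih.2]

lemma append_cons_lt_append_cons {B : Type*} [LinearOrder B] (b : B) {l l' r r' : List B}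
    (hl : l.length = l'.length) (h : l ++ r < l' ++ r') : l ++ b :: r < l' ++ b :: r' := by
  induction l generalizing l' with
  | nil =>
    obtain rfl : l' = [] := List.length_eq_zero_iff.1 hl.symm
    exact List.cons_lt_cons_iff.2 (.inr ⟨rfl, h⟩)
  | cons a l ih =>
    cases l' with
    | nil => simp at hl
    | cons a' l' =>
      rw [List.cons_append, List.cons_append, List.cons_lt_cons_iff] at h ⊢
      exact h.imp_right fun h => ⟨h.1, ih (by simpa using hl) h.2⟩

section InsertWord

variable {K V B : Type*} [Field K] [AddCommGroup V] [Module K V] [LinearOrder B]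
  (s : B) (f : ℕ → B → V →ₗ[K] V)

/-- Given operators `f p b`, to be thought of as inserting the letter `b` at position `p`,
insert all letters of a word other than `s` at their positions, from left to right. -/
def insertWord : ℕ → List B → V → V
  | _, [], x => x
  | q, b :: w, x => insertWord (q + 1) w (if b = s then x else f q b x)

variable {s f}

lemma insertWord_replicate (n q : ℕ) (x : V) : insertWord s f q (List.replicate n s) x = x := by
  induction n generalizing q with
  | zero => rfl
  | succ n ih => simpa [List.replicate_succ, insertWord] using ih (q + 1)

lemma map_insertWord
    (hcomm : ∀ q r b c x, q ≤ r → f q b (f r c x) = f (r + 1) c (f q b x))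
    {q r : ℕ} (hqr : q ≤ r) (b : B) (w : List B) (x : V) :
    f q b (insertWord s f r w x) = insertWord s f (r + 1) w (f q b x) := by
  induction w generalizing r x with
  | nil => rfl
  | cons c w ih =>
    rw [insertWord, insertWord, ih (by omega)]
    split_ifs
    · rfl
    · rw [hcomm _ _ _ _ _ hqr]

lemma map_insertWord_append
    (hcomm : ∀ q r b c x, q ≤ r → f q b (f r c x) = f (r + 1) c (f q b x))
    {b : B} (hb : b ≠ s) (q : ℕ) (l r : List B) (x : V) :
    f (q + l.length) b (insertWord s f q (l ++ r) x) = insertWord s f q (l ++ b :: r) x := by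
  induction l generalizing q x with
  | nil => simpa [insertWord, hb] using map_insertWord hcomm le_rfl b r x
  | cons a l ih =>
    rw [List.cons_append, List.cons_append, insertWord, insertWord, ← ih, List.length_cons]
    congr 2
    omega

variable {H : ℕ → Submodule K V}

lemma insertWord_mem
    (hH : ∀ n p b, ∀ x ∈ H n, f p b x ∈ H (n + 1))
    {n m : ℕ} (q : ℕ) (w : List B) (hw : n + w.length = m + w.count s) {x : V}
    (hx : x ∈ H n) : insertWord s f q w x ∈ H m := by
  induction w generalizing q n x with
  | nil =>
    obtain rfl : n = m := by simpa using hw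
    exact hx
  | cons a w ih =>
    rw [insertWord]
    split_ifs with h
    · subst h
      refine ih _ ?_ hx
      simp only [List.length_cons, List.count_cons_self] at hw
      omega
    · refine ih _ ?_ (hH n q a x hx)
      rw [List.length_cons, List.count_cons_of_ne h] at hw
      omega

variable [Fintype B] {N m : ℕ} (e : Fin m → V)

variable (s f N) in
/-- The vector indexed by a generator and a word. -/
def wordVector (i : Fin m ×ₗ List B) : V := insertWord s f 0 (ofLex i).2 (e (ofLex i).1)

variable (s N m) in
/-- The indices of the word vectors of degree `n`. -/
def wordIndex (n : ℕ) : Finset (Fin m ×ₗ List B) :=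
  (Finset.univ ×ˢ (words B n).filter fun w => w.count s = N).map toLex.toEmbedding

lemma mem_wordIndex {n : ℕ} {j : Fin m} {w : List B} :
    toLex (j, w) ∈ wordIndex s N m n ↔ w.length = n ∧ w.count s = N := by
  simp [wordIndex, mem_words]

lemma span_wordVector
    (hcomm : ∀ q r b c x, q ≤ r → f q b (f r c x) = f (r + 1) c (f q b x))
    (hH : ∀ n p b, ∀ x ∈ H n, f p b x ∈ H (n + 1))
    (hspan : ∀ n, N ≤ n → H (n + 1) ≤
      Submodule.span K {y | ∃ p ≤ n, ∃ b ≠ s, ∃ x ∈ H n, y = f p b x})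
    (he : Submodule.span K (Set.range e) = H N) {n : ℕ} (hn : N ≤ n) :
    Submodule.span K (wordVector s f e '' wordIndex s N m n) = H n := by
  apply le_antisymm
  · rw [Submodule.span_le]
    rintro _ ⟨i, hi, rfl⟩
    obtain ⟨⟨j, w⟩, rfl⟩ := toLex.surjective i
    obtain ⟨h1, h2⟩ := mem_wordIndex.1 (Finset.mem_coe.1 hi)
    exact insertWord_mem hH 0 w (by omega) (he ▸ Submodule.subset_span (Set.mem_range_self j))
  · induction n, hn using Nat.le_induction with
    | base =>
      rw [← he, Submodule.span_le]
      rintro _ ⟨j, rfl⟩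
      refine Submodule.subset_span ⟨toLex (j, List.replicate N s), ?_, ?_⟩
      · exact Finset.mem_coe.2 (mem_wordIndex.2 (by simp))
      · exact insertWord_replicate N 0 (e j)
    | succ n hn ih =>
      refine (hspan n hn).trans (Submodule.span_le.2 ?_)
      rintro _ ⟨p, hp, b, hb, x, hx, rfl⟩
      have := Submodule.mem_map_of_mem (f := f p b) (ih hx)
      rw [Submodule.map_span] at this
      refine Submodule.span_mono ?_ this
      rintro _ ⟨_, ⟨i, hi, rfl⟩, rfl⟩
      obtain ⟨⟨j, w⟩, rfl⟩ := toLex.surjective i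
      obtain ⟨h1, h2⟩ := mem_wordIndex.1 (Finset.mem_coe.1 hi)
      refine ⟨toLex (j, w.take p ++ b :: w.drop p), ?_, ?_⟩
      · refine Finset.mem_coe.2 (mem_wordIndex.2 ⟨?_, ?_⟩)
        · simp only [List.length_append, List.length_cons, List.length_take, List.length_drop]
          omega
        · rw [List.count_append, List.count_cons_of_ne hb, ← List.count_append,
            List.take_append_drop, h2]
      · have := map_insertWord_append hcomm hb 0 (w.take p) (w.drop p) (e j)
        rw [List.take_append_drop, List.length_take, zero_add, min_eq_left (by omega)] at this
        exact this.symm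

variable (s f N) in
/-- The words whose vector is a combination of the preceding word vectors of the same degree. -/
def reducibleWords (j : Fin m) : Set (List B) :=
  {w | wordVector s f e (toLex (j, w)) ∈ Submodule.span K
    (wordVector s f e '' {i | i ∈ wordIndex s N m w.length ∧ i < toLex (j, w)})}

lemma append_cons_mem_reducibleWords
    (hcomm : ∀ q r b c x, q ≤ r → f q b (f r c x) = f (r + 1) c (f q b x))
    (j : Fin m) (l r : List B) (b : B) (hb : b ≠ s)
    (h : l ++ r ∈ reducibleWords s f N e j) : l ++ b :: r ∈ reducibleWords s f N e j := by
  rw [reducibleWords, Set.mem_ofPred_eq] at h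
  have h := Submodule.mem_map_of_mem (f := f l.length b) h
  rw [Submodule.map_span] at h
  have e1 := map_insertWord_append hcomm hb 0 l r (e j)
  rw [zero_add] at e1
  simp only [wordVector, ofLex_toLex] at h
  rw [e1] at h
  refine Submodule.span_mono ?_ h
  rintro _ ⟨_, ⟨i, ⟨hi, hlt⟩, rfl⟩, rfl⟩
  obtain ⟨⟨k, w⟩, rfl⟩ := toLex.surjective i
  obtain ⟨h1, h2⟩ := mem_wordIndex.1 hi
  have hlen : (w.take l.length).length = l.length := by
    rw [List.length_take, h1, List.length_append]
    omega
  refine ⟨toLex (k, w.take l.length ++ b :: w.drop l.length), ⟨mem_wordIndex.2 ⟨?_, ?_⟩, ?_⟩, ?_⟩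
  · simp only [List.length_append, List.length_cons, List.length_take, List.length_drop] at h1 ⊢
    omega
  · rw [List.count_append, List.count_cons_of_ne hb, ← List.count_append,
      List.take_append_drop, h2]
  · rw [Prod.Lex.toLex_lt_toLex] at hlt ⊢
    refine hlt.imp_right fun h => ⟨h.1, append_cons_lt_append_cons b hlen ?_⟩
    rw [List.take_append_drop]
    exact h.2
  · have := map_insertWord_append hcomm hb 0 (w.take l.length) (w.drop l.length) (e k)
    rw [List.take_append_drop, hlen, zero_add] at this
    exact this.symm

/-- The dimensions of a graded vector space that is generated in degree `N` by insertion operators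
`f p b` satisfying the simplicial identities. -/
theorem isPolyExp_finrank [∀ n, FiniteDimensional K (H n)]
    (hcomm : ∀ q r b c x, q ≤ r → f q b (f r c x) = f (r + 1) c (f q b x))
    (hH : ∀ n p b, ∀ x ∈ H n, f p b x ∈ H (n + 1))
    (hspan : ∀ n, N ≤ n → H (n + 1) ≤
      Submodule.span K {y | ∃ p ≤ n, ∃ b ≠ s, ∃ x ∈ H n, y = f p b x}) :
    IsPolyExp fun n => (Module.finrank K (H n) : ℚ) := by
  classical
  let bas := Module.finBasis K (H N)
  let e : Fin (Module.finrank K (H N)) → V := fun j => bas j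
  have he : Submodule.span K (Set.range e) = H N := by
    have : Set.range e = (H N).subtype '' Set.range bas := by
      rw [← Set.range_comp]; rfl
    rw [this, ← Submodule.map_span, bas.span_eq, Submodule.map_top, Submodule.range_subtype]
  let D (j : Fin (Module.finrank K (H N))) : Set (List B) :=
    {u | ∃ w, List.Sublist u w ∧ w.count s = N ∧ w ∉ reducibleWords s f N e j}
  have hD (j) : IsSubwordClosed (D j) := fun u w h ⟨w', h1, h2⟩ => ⟨w', h.trans h1, h2⟩
  have hDj (j) (u : List B) (hu : u.count s = N) :
      u ∈ D j ↔ u ∉ reducibleWords s f N e j := by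
    refine ⟨fun ⟨w, h1, h2, h3⟩ h => h3 ?_, fun h => ⟨u, List.Sublist.refl u, hu, h⟩⟩
    exact mem_of_sublist_of_count_eq (append_cons_mem_reducibleWords e hcomm j) h1
      (hu.trans h2.symm) h
  refine IsPolyExp.of_eventually_eq (N := N) (IsPolyExp.sum (s := Finset.univ)
    fun j _ => isPolyExp_wordCount s N (hD j)) fun n hn => ?_
  rw [← span_wordVector e hcomm hH hspan he hn, finrank_span_image_eq_card, Finset.card_filter,
    wordIndex, Finset.sum_map, Finset.sum_product, Nat.cast_sum]
  refine Finset.sum_congr rfl fun j _ => ?_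
  rw [Finset.sum_filter, wordCount, Nat.cast_sum]
  refine Finset.sum_congr rfl fun w hw => ?_
  rw [mem_words] at hw
  subst hw
  by_cases hc : w.count s = N
  · simp only [hc, if_true, Set.mem_ofPred_eq, and_true, hDj j w hc]
    simp [reducibleWords, wordIndex]
  · simp [hc]

end InsertWord

lemma permExtend_castSucc {n : ℕ} (σ : Equiv.Perm (Fin n)) (i : Fin n) :
    permExtend σ i.castSucc = (σ i).castSucc :=
  Equiv.Perm.viaFintypeEmbedding_apply_image σ Fin.castSuccEmb i

lemma permExtend_last {n : ℕ} (σ : Equiv.Perm (Fin n)) : permExtend σ (Fin.last n) = Fin.last n :=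
  Equiv.Perm.viaFintypeEmbedding_apply_notMem_range σ Fin.castSuccEmb
    (by rintro ⟨i, hi⟩; exact (Fin.castSucc_lt_last i).ne hi)

/-- The permutation that moves the last letter to position `i` and preserves the order of the
other letters. -/
def moveLast {n : ℕ} (i : Fin (n + 1)) : Equiv.Perm (Fin (n + 1)) :=
  (finSuccEquiv' (Fin.last n)).trans (finSuccEquiv' i).symm

lemma moveLast_last {n : ℕ} (i : Fin (n + 1)) : moveLast i (Fin.last n) = i := by
  simp [moveLast]

lemma moveLast_castSucc {n : ℕ} (i : Fin (n + 1)) (k : Fin n) :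
    moveLast i k.castSucc = i.succAbove k := by
  rw [← Fin.succAbove_last_apply, moveLast, Equiv.trans_apply, finSuccEquiv'_succAbove,
    finSuccEquiv'_symm_some]

lemma moveLast_mul_permExtend {n : ℕ} {i j : Fin (n + 1)} (h : i ≤ j) :
    moveLast i.castSucc * permExtend (moveLast j) =
      moveLast j.succ * permExtend (moveLast i) *
        Equiv.swap (Fin.last n).castSucc (Fin.last (n + 1)) := by
  ext x
  induction x using Fin.lastCases with
  | last =>
    simp only [Equiv.Perm.mul_apply, Equiv.swap_apply_right, permExtend_last, permExtend_castSucc,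
      moveLast_last, moveLast_castSucc]
    rw [Fin.succAbove_of_castSucc_lt _ _ (Fin.castSucc_lt_succ_iff.2 h)]
  | cast x =>
    induction x using Fin.lastCases with
    | last =>
      simp only [Equiv.Perm.mul_apply, Equiv.swap_apply_left, permExtend_last,
        permExtend_castSucc, moveLast_last, moveLast_castSucc]
      rw [Fin.succAbove_of_le_castSucc _ _ (by simpa using h)]
    | cast k =>
      rw [Equiv.Perm.mul_apply, Equiv.Perm.mul_apply, Equiv.Perm.mul_apply,
        Equiv.swap_apply_of_ne_of_ne (by simp [Fin.ext_iff, k.2.ne])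
          (by simp [Fin.ext_iff]; omega)]
      simp only [permExtend_castSucc, moveLast_castSucc]
      have h' : (i : ℕ) ≤ j := h
      simp only [Fin.succAbove, Fin.lt_def, apply_ite Fin.val, Fin.val_castSucc, Fin.val_succ]
      split_ifs <;> omega

lemma exists_eq_moveLast_mul_permExtend {n : ℕ} (σ : Equiv.Perm (Fin (n + 1))) :
    ∃ τ : Equiv.Perm (Fin n), σ = moveLast (σ (Fin.last n)) * permExtend τ := by
  set g := (moveLast (σ (Fin.last n)))⁻¹ * σ with hg
  have hlast : g (Fin.last n) = Fin.last n := by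
    rw [hg, Equiv.Perm.mul_apply, Equiv.Perm.inv_eq_iff_eq, moveLast_last]
  have hne (k : Fin n) : g k.castSucc ≠ Fin.last n := by
    intro h
    exact (Fin.castSucc_lt_last k).ne (g.injective (h.trans hlast.symm))
  let t : Fin n → Fin n := fun k => (g k.castSucc).castPred (hne k)
  have ht : Function.Injective t := fun a b hab => by simpa [t, Fin.castPred_inj] using hab
  refine ⟨Equiv.ofBijective t (Finite.injective_iff_bijective.1 ht), ?_⟩
  rw [← inv_mul_eq_iff_eq_mul, ← hg]
  ext x
  induction x using Fin.lastCases with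
  | last => rw [hlast, permExtend_last]
  | cast k => rw [permExtend_castSucc]; simp [t]

namespace SeqModule

variable {U : Type} [AddCommGroup U] [Module ℂ U] (𝕄 : SeqModule U)

/-- Multiplication by `u`, with the new letter inserted at position `i`. -/
def insertAt (n : ℕ) (i : Fin (n + 1)) (u : U) : 𝕄.M n →ₗ[ℂ] 𝕄.M (n + 1) :=
  𝕄.ρ (n + 1) (moveLast i) ∘ₗ 𝕄.μ n u

lemma insertAt_insertAt {n : ℕ} {i j : Fin (n + 1)} (h : i ≤ j) (u v : U) (x : 𝕄.M n) :
    𝕄.insertAt (n + 1) i.castSucc u (𝕄.insertAt n j v x) =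
      𝕄.insertAt (n + 1) j.succ v (𝕄.insertAt n i u x) := by
  simp only [insertAt, LinearMap.comp_apply]
  rw [𝕄.equivariant, 𝕄.equivariant, ← 𝕄.symmetric n u v x]
  simp only [← Module.End.mul_apply, ← map_mul]
  rw [moveLast_mul_permExtend h, mul_assoc]

/-- The insertion operator at position `p` on the product of all components of a module. It
vanishes on the components of degree less than `p`. -/
def insertTotal (p : ℕ) (u : U) : (∀ n, 𝕄.M n) →ₗ[ℂ] ∀ n, 𝕄.M n :=
  LinearMap.pi fun
    | 0 => 0
    | n + 1 => if h : p < n + 1 then 𝕄.insertAt n ⟨p, h⟩ u ∘ₗ LinearMap.proj n else 0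

lemma insertTotal_zero (p : ℕ) (u : U) (x : ∀ n, 𝕄.M n) : 𝕄.insertTotal p u x 0 = 0 := rfl

lemma insertTotal_succ (p : ℕ) (u : U) (x : ∀ n, 𝕄.M n) (n : ℕ) :
    𝕄.insertTotal p u x (n + 1) =
      if h : p < n + 1 then 𝕄.insertAt n ⟨p, h⟩ u (x n) else 0 := by
  change (if h : p < n + 1 then 𝕄.insertAt n ⟨p, h⟩ u ∘ₗ LinearMap.proj n else 0 :
    (∀ n, 𝕄.M n) →ₗ[ℂ] 𝕄.M (n + 1)) x = _
  split_ifs <;> rfl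

lemma insertTotal_insertTotal {q r : ℕ} (h : q ≤ r) (u v : U) (x : ∀ n, 𝕄.M n) :
    𝕄.insertTotal q u (𝕄.insertTotal r v x) =
      𝕄.insertTotal (r + 1) v (𝕄.insertTotal q u x) := by
  funext n
  match n with
  | 0 => rfl
  | 1 => simp [insertTotal_succ, insertTotal_zero]
  | n + 2 =>
    rw [insertTotal_succ, insertTotal_succ, insertTotal_succ, insertTotal_succ]
    by_cases hr : r < n + 1
    · rw [dif_pos (by omega), dif_pos hr, dif_pos (by omega), dif_pos (by omega)]
      exact 𝕄.insertAt_insertAt (i := ⟨q, by omega⟩) (j := ⟨r, hr⟩) h u v (x n)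
    · rw [dif_neg hr, dif_neg (show ¬ r + 1 < n + 1 + 1 by omega)]
      split_ifs <;> simp only [map_zero]

/-- The homogeneous component of degree `n` of the product of all components. -/
def homogeneous (n : ℕ) : Submodule ℂ (∀ n, 𝕄.M n) :=
  LinearMap.range (LinearMap.single ℂ 𝕄.M n)

/-- The homogeneous component of degree `n` is isomorphic to `M n`. -/
def homogeneousEquiv (n : ℕ) : 𝕄.M n ≃ₗ[ℂ] 𝕄.homogeneous n :=
  LinearEquiv.ofInjective _ (Pi.single_injective n)

instance (n : ℕ) : FiniteDimensional ℂ (𝕄.homogeneous n) :=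
  (𝕄.homogeneousEquiv n).finiteDimensional

lemma insertTotal_single (p : ℕ) (u : U) (n : ℕ) (x : 𝕄.M n) :
    𝕄.insertTotal p u (Pi.single n x) =
      Pi.single (n + 1) (if h : p < n + 1 then 𝕄.insertAt n ⟨p, h⟩ u x else 0) := by
  funext k
  cases k with
  | zero => rw [insertTotal_zero, Pi.single_eq_of_ne (by omega)]
  | succ k =>
    rw [insertTotal_succ]
    by_cases hk : k = n
    · subst hk
      simp
    · rw [Pi.single_eq_of_ne hk, Pi.single_eq_of_ne (by omega)]
      simp

lemma insertTotal_mem (n p : ℕ) (u : U) {x : ∀ n, 𝕄.M n} (hx : x ∈ 𝕄.homogeneous n) :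
    𝕄.insertTotal p u x ∈ 𝕄.homogeneous (n + 1) := by
  obtain ⟨x, rfl⟩ := hx
  exact ⟨_, (𝕄.insertTotal_single p u n x).symm⟩

lemma insertTotal_add (p : ℕ) (u v : U) (x : ∀ n, 𝕄.M n) :
    𝕄.insertTotal p (u + v) x = 𝕄.insertTotal p u x + 𝕄.insertTotal p v x := by
  funext n
  cases n with
  | zero => simp [insertTotal_zero]
  | succ n =>
    simp only [insertTotal_succ, Pi.add_apply]
    split_ifs <;> simp [insertAt]

lemma insertTotal_smul (p : ℕ) (a : ℂ) (u : U) (x : ∀ n, 𝕄.M n) :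
    𝕄.insertTotal p (a • u) x = a • 𝕄.insertTotal p u x := by
  funext n
  cases n with
  | zero => simp [insertTotal_zero]
  | succ n =>
    simp only [insertTotal_succ, Pi.smul_apply]
    split_ifs <;> simp [insertAt]

lemma exists_homogeneous_le_span : ∃ N, ∀ n, N ≤ n → 𝕄.homogeneous (n + 1) ≤ Submodule.span ℂ
    {y | ∃ p ≤ n, ∃ u : U, ∃ x ∈ 𝕄.homogeneous n, y = 𝕄.insertTotal p u x} := by
  obtain ⟨N, hN⟩ := 𝕄.finitelyGenerated
  refine ⟨N, fun n hn => ?_⟩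
  rw [homogeneous, LinearMap.range_eq_map]
  refine (Submodule.map_mono (hN n hn)).trans ?_
  rw [Submodule.map_span]
  refine Submodule.span_mono ?_
  rintro _ ⟨_, ⟨σ, u, x, rfl⟩, rfl⟩
  obtain ⟨τ, hτ⟩ := exists_eq_moveLast_mul_permExtend σ
  set i := σ (Fin.last n)
  refine ⟨i, by omega, u, Pi.single n (𝕄.ρ n τ x), ⟨_, rfl⟩, ?_⟩
  rw [insertTotal_single, dif_pos i.2]
  simp only [insertAt, LinearMap.comp_apply, 𝕄.equivariant, LinearMap.coe_single]
  rw [hτ, map_mul, Module.End.mul_apply]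

lemma isPolyExp_finrank [FiniteDimensional ℂ U] :
    IsPolyExp fun n => (Module.finrank ℂ (𝕄.M n) : ℚ) := by
  obtain ⟨N, hN⟩ := 𝕄.exists_homogeneous_le_span
  let bas := Module.finBasis ℂ U
  let f (p : ℕ) (b : Fin (Module.finrank ℂ U + 1)) :=
    𝕄.insertTotal p ((Fin.cons 0 bas : Fin (Module.finrank ℂ U + 1) → U) b)
  have hspan (n : ℕ) (hn : N ≤ n) : 𝕄.homogeneous (n + 1) ≤ Submodule.span ℂ
      {y | ∃ p ≤ n, ∃ b ≠ 0, ∃ x ∈ 𝕄.homogeneous n, y = f p b x} := by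
    refine (hN n hn).trans (Submodule.span_le.2 ?_)
    rintro _ ⟨p, hp, u, x, hx, rfl⟩
    rw [← bas.sum_repr u]
    let φ : U →ₗ[ℂ] ∀ n, 𝕄.M n :=
      { toFun := fun u => 𝕄.insertTotal p u x
        map_add' := fun u v => 𝕄.insertTotal_add p u v x
        map_smul' := fun a u => 𝕄.insertTotal_smul p a u x }
    change φ _ ∈ _
    rw [map_sum]
    refine sum_mem fun c _ => ?_
    rw [map_smul]
    exact Submodule.smul_mem _ _ (Submodule.subset_span ⟨p, hp, c.succ, Fin.succ_ne_zero c, x, hx,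
      by simp [f, φ]⟩)
  have := _root_.isPolyExp_finrank (s := 0) (f := f) (H := 𝕄.homogeneous)
    (fun q r b c x h => 𝕄.insertTotal_insertTotal h _ _ x)
    (fun n p b x hx => 𝕄.insertTotal_mem n p _ hx) hspan
  simpa only [fun n => (𝕄.homogeneousEquiv n).finrank_eq] using this

end SeqModule

/-- The exponential Hilbert series of a finitely generated module over a twisted commutative
algebra `Sym(U⟨1⟩)` generated in order `1` is a polynomial in `t` and `e^t`. -/
theorem exp_hilbert_series_polynomial_in_t_and_exp
    (U : Type) [AddCommGroup U] [Module ℂ U] [FiniteDimensional ℂ U]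
    (𝕄 : SeqModule U) :
    ∃ P : MvPolynomial (Fin 2) ℚ,
      (PowerSeries.mk fun n =>
          (Module.finrank ℂ (𝕄.M n) : ℚ) / (Nat.factorial n : ℚ)) =
        MvPolynomial.aeval ![PowerSeries.X, PowerSeries.exp ℚ] P := by
  obtain ⟨P, hP⟩ := 𝕄.isPolyExp_finrank
  exact ⟨P, hP.symm⟩
end
end
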